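/- arXiv:2404.16438 — 2 statements merged into one kernel-verified Lean document; each statement's English description precedes it below -/
import Mathlib

section
/- Let N ≥ 1, let V : ℝ^N → [0,∞) be measurable, and let s ∈ (0,1). Suppose there exists an open set G ∈ 𝒢 with ∫_G V(x) dx < ∞. Then inf { [φ]_{W^{s,2}}² + ∫_{ℝ^N} V(x) |φ(x)|² dx : φ ∈ C_c^∞(ℝ^N), ‖φ‖_{L²(ℝ^N)} = 1 } = 0. -/
open MeasureTheory Metric Filter ENNReal

/-- The class `𝒢` of open sets containing arbitrarily large balls. -/
def InG {N : ℕ} (G : Set (EuclideanSpace ℝ (Fin N))) : Prop :=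
  IsOpen G ∧ ∀ r : ℝ, 0 < r → ∃ x₀ : EuclideanSpace ℝ (Fin N), ball x₀ r ⊆ G

/-- The squared Gagliardo seminorm `[φ]_{W^{s,2}}²`. -/
noncomputable def gagliardoSq {N : ℕ} (s : ℝ) (φ : EuclideanSpace ℝ (Fin N) → ℝ) : ℝ≥0∞ :=
  ∫⁻ x : EuclideanSpace ℝ (Fin N), ∫⁻ y : EuclideanSpace ℝ (Fin N),
    ENNReal.ofReal (|φ x - φ y| ^ 2 / ‖x - y‖ ^ ((N : ℝ) + 2 * s))

theorem aux_fin {N : ℕ} (hN : 1 ≤ N) {s : ℝ} (hs : s ∈ Set.Ioo (0 : ℝ) 1) :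
    ∫⁻ z : EuclideanSpace ℝ (Fin N),
      ENNReal.ofReal (min (‖z‖ ^ 2) 1 / ‖z‖ ^ ((N : ℝ) + 2 * s)) ≠ ⊤ := by
  obtain ⟨hs0, hs1⟩ := hs
  have : Nonempty (Fin N) := ⟨⟨0, hN⟩⟩
  have key : Integrable (fun z : EuclideanSpace ℝ (Fin N) =>
      (fun r : ℝ => min (r ^ 2) 1 / r ^ ((N : ℝ) + 2 * s)) ‖z‖) volume := by
    refine (integrable_fun_norm_addHaar (volume : Measure (EuclideanSpace ℝ (Fin N)))
      (f := fun r : ℝ => min (r ^ 2) 1 / r ^ ((N : ℝ) + 2 * s))).2 ?_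
    have h01 : Set.Ioi (0 : ℝ) = Set.Ioc 0 1 ∪ Set.Ioi 1 := by
      rw [Set.Ioc_union_Ioi_eq_Ioi zero_le_one]
    have hpow : ∀ y : ℝ, 0 < y → y ^ (N - 1) = y ^ ((N : ℝ) - 1) := by
      intro y hy
      rw [← Real.rpow_natCast, Nat.cast_sub hN, Nat.cast_one]
    rw [h01, integrableOn_union]
    constructor
    · have h1 : IntegrableOn (fun y : ℝ => y ^ (1 - 2 * s)) (Set.Ioc 0 1) volume := by
        have := intervalIntegral.intervalIntegrable_rpow' (a := 0) (b := 1) (r := 1 - 2 * s)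
          (by linarith)
        rwa [intervalIntegrable_iff_integrableOn_Ioc_of_le zero_le_one] at this
      refine h1.congr_fun ?_ measurableSet_Ioc
      intro y hy
      have hy0 : 0 < y := hy.1
      have hm : min (y ^ 2) 1 = y ^ (2 : ℝ) := by
        rw [min_eq_left (by nlinarith [hy.1, hy.2])]; norm_cast
      simp only [finrank_euclideanSpace, Fintype.card_fin, smul_eq_mul]
      rw [hm, hpow y hy0, ← Real.rpow_sub hy0, ← Real.rpow_add hy0]
      congr 1; ring
    · have h1 : IntegrableOn (fun y : ℝ => y ^ (-1 - 2 * s)) (Set.Ioi 1) volume :=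
        integrableOn_Ioi_rpow_of_lt (by linarith) one_pos
      refine h1.congr_fun ?_ measurableSet_Ioi
      intro y hy
      have hy1 : 1 < y := hy
      have hy0 : 0 < y := by linarith
      have hm : min (y ^ 2) 1 = y ^ (0 : ℝ) := by
        rw [min_eq_right (by nlinarith), Real.rpow_zero]
      simp only [finrank_euclideanSpace, Fintype.card_fin, smul_eq_mul]
      rw [hm, hpow y hy0, ← Real.rpow_sub hy0, ← Real.rpow_add hy0]
      congr 1; ring
  have := key.lintegral_lt_top
  exact this.ne

theorem aux_tendsto {N : ℕ} (hN : 1 ≤ N) {s : ℝ} (hs : s ∈ Set.Ioo (0 : ℝ) 1) :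
    Tendsto (fun n : ℕ => ∫⁻ z : EuclideanSpace ℝ (Fin N),
      ENNReal.ofReal (min ((‖z‖ / ((n : ℝ) + 1)) ^ 2) 1 / ‖z‖ ^ ((N : ℝ) + 2 * s)))
      atTop (nhds 0) := by
  have h := tendsto_lintegral_of_dominated_convergence (μ := volume)
    (F := fun (n : ℕ) (z : EuclideanSpace ℝ (Fin N)) =>
      ENNReal.ofReal (min ((‖z‖ / ((n : ℝ) + 1)) ^ 2) 1 / ‖z‖ ^ ((N : ℝ) + 2 * s)))
    (f := fun _ => 0)
    (fun z => ENNReal.ofReal (min (‖z‖ ^ 2) 1 / ‖z‖ ^ ((N : ℝ) + 2 * s)))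
    (fun n => by fun_prop) ?_ (aux_fin hN hs) ?_
  · simpa using h
  · intro n
    refine ae_of_all _ fun z => ?_
    apply ENNReal.ofReal_le_ofReal
    have : ‖z‖ / ((n : ℝ) + 1) ≤ ‖z‖ :=
      div_le_self (norm_nonneg _) (by linarith [(Nat.cast_nonneg n : (0 : ℝ) ≤ n)])
    gcongr
  · refine ae_of_all _ fun z => ?_
    rw [← ENNReal.ofReal_zero]
    apply ENNReal.tendsto_ofReal
    have h1 : Tendsto (fun n : ℕ => ‖z‖ / ((n : ℝ) + 1)) atTop (nhds 0) := by
      have := (tendsto_one_div_add_atTop_nhds_zero_nat (𝕜 := ℝ)).const_mul ‖z‖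
      simpa [div_eq_mul_inv] using this
    have h2 := ((h1.pow 2).min (tendsto_const_nhds (x := (1 : ℝ)))).div_const
      (‖z‖ ^ ((N : ℝ) + 2 * s))
    simpa using h2

theorem aux_gag {N : ℕ} (s : ℝ) (φ : EuclideanSpace ℝ (Fin N) → ℝ)
    (K : Set (EuclideanSpace ℝ (Fin N))) (hK : MeasurableSet K)
    (h : EuclideanSpace ℝ (Fin N) → ℝ≥0∞) (hh : Measurable h) (c : ℝ≥0∞)
    (hb : ∀ x y, x ∈ K ∨ y ∈ K →
      ENNReal.ofReal (|φ x - φ y| ^ 2 / ‖x - y‖ ^ ((N : ℝ) + 2 * s)) ≤ c * h (x - y))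
    (h0 : ∀ x, x ∉ K → φ x = 0) :
    gagliardoSq s φ ≤ c * (2 * volume K * ∫⁻ z, h z) := by
  have hpt : ∀ x y, ENNReal.ofReal (|φ x - φ y| ^ 2 / ‖x - y‖ ^ ((N : ℝ) + 2 * s)) ≤
      c * (K.indicator 1 x * h (x - y) + K.indicator 1 y * h (x - y)) := by
    intro x y
    by_cases hx : x ∈ K
    · refine (hb x y (Or.inl hx)).trans ?_
      simp only [Set.indicator_of_mem hx, Pi.one_apply, one_mul]
      gcongr
      exact le_self_add
    · by_cases hy : y ∈ K
      · refine (hb x y (Or.inr hy)).trans ?_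
        simp only [Set.indicator_of_mem hy, Pi.one_apply, one_mul]
        gcongr
        exact le_add_self
      · simp [h0 x hx, h0 y hy]
  have hind : Measurable (K.indicator (1 : EuclideanSpace ℝ (Fin N) → ℝ≥0∞)) :=
    measurable_one.indicator hK
  have hm1 : Measurable (fun p : EuclideanSpace ℝ (Fin N) × EuclideanSpace ℝ (Fin N) =>
      K.indicator 1 p.1 * h (p.1 - p.2)) := by fun_prop
  have hm2 : Measurable (fun p : EuclideanSpace ℝ (Fin N) × EuclideanSpace ℝ (Fin N) =>
      K.indicator 1 p.2 * h (p.1 - p.2)) := by fun_prop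
  have e1 : ∫⁻ x : EuclideanSpace ℝ (Fin N), ∫⁻ y : EuclideanSpace ℝ (Fin N),
      K.indicator 1 x * h (x - y) = volume K * ∫⁻ z, h z := by
    have : ∀ x : EuclideanSpace ℝ (Fin N), ∫⁻ y : EuclideanSpace ℝ (Fin N),
      K.indicator 1 x * h (x - y) = K.indicator 1 x * ∫⁻ z, h z := by
      intro x
      rw [lintegral_const_mul _ (by fun_prop), lintegral_sub_left_eq_self]
    simp_rw [this]
    rw [lintegral_mul_const _ hind, lintegral_indicator_one hK]
  have e2 : ∫⁻ x : EuclideanSpace ℝ (Fin N), ∫⁻ y : EuclideanSpace ℝ (Fin N),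
      K.indicator 1 y * h (x - y) = volume K * ∫⁻ z, h z := by
    rw [lintegral_lintegral_swap hm2.aemeasurable]
    have : ∀ y : EuclideanSpace ℝ (Fin N), ∫⁻ x : EuclideanSpace ℝ (Fin N),
      K.indicator 1 y * h (x - y) = K.indicator 1 y * ∫⁻ z, h z := by
      intro y
      rw [lintegral_const_mul _ (by fun_prop), lintegral_sub_right_eq_self]
    simp_rw [this]
    rw [lintegral_mul_const _ hind, lintegral_indicator_one hK]
  calc gagliardoSq s φ ≤ ∫⁻ x : EuclideanSpace ℝ (Fin N), ∫⁻ y : EuclideanSpace ℝ (Fin N),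
        c * (K.indicator 1 x * h (x - y) + K.indicator 1 y * h (x - y)) :=
      lintegral_mono fun x => lintegral_mono fun y => hpt x y
    _ = c * ((∫⁻ x : EuclideanSpace ℝ (Fin N), ∫⁻ y : EuclideanSpace ℝ (Fin N),
          K.indicator 1 x * h (x - y)) +
          ∫⁻ x : EuclideanSpace ℝ (Fin N), ∫⁻ y : EuclideanSpace ℝ (Fin N),
          K.indicator 1 y * h (x - y)) := by
      rw [← lintegral_add_left hm1.lintegral_prod_right', ← lintegral_const_mul]
      · refine lintegral_congr fun x => ?_
        rw [← lintegral_add_left (by fun_prop), ← lintegral_const_mul _ (by fun_prop)]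
      · exact hm1.lintegral_prod_right'.add hm2.lintegral_prod_right'
    _ = c * (2 * volume K * ∫⁻ z, h z) := by rw [e1, e2]; ring

theorem aux_bump (N : ℕ) : ∃ φ : EuclideanSpace ℝ (Fin N) → ℝ,
    ContDiff ℝ (⊤ : ℕ∞) φ ∧ HasCompactSupport φ ∧ ∫ x, (φ x) ^ 2 = 1 ∧
    ∀ x, x ∉ ball (0 : EuclideanSpace ℝ (Fin N)) 1 → φ x = 0 := by
  let f : ContDiffBump (0 : EuclideanSpace ℝ (Fin N)) := ⟨1 / 2, 1, by norm_num, by norm_num⟩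
  have hf1 : ContDiff ℝ (⊤ : ℕ∞) f := f.contDiff
  have hf2 : HasCompactSupport f := f.hasCompactSupport
  have hpos : 0 < ∫ x, (f x) ^ 2 := by
    apply Continuous.integral_pos_of_hasCompactSupport_nonneg_nonzero (x := 0)
    · exact f.continuous.pow 2
    · exact hf2.comp_left (g := fun t : ℝ => t ^ 2) (by simp)
    · intro x; positivity
    · rw [f.one_of_mem_closedBall (mem_closedBall_self f.rIn_pos.le)]; simp
  refine ⟨fun x => (Real.sqrt (∫ x, (f x) ^ 2))⁻¹ * f x, contDiff_const.mul hf1,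
    hf2.mul_left, ?_, ?_⟩
  · simp_rw [mul_pow]
    rw [integral_const_mul, inv_pow, Real.sq_sqrt hpos.le, inv_mul_cancel₀ hpos.ne']
  · intro x hx
    have : f x = 0 := by
      rw [← Function.notMem_support, f.support_eq]; exact hx
    simp [this]

theorem stmt14 {N : ℕ} (hN : 1 ≤ N) {s : ℝ} (hs : s ∈ Set.Ioo (0 : ℝ) 1)
    (V : EuclideanSpace ℝ (Fin N) → ℝ) (hV : Measurable V) (hV0 : ∀ x, 0 ≤ V x)
    (hG : ∃ G : Set (EuclideanSpace ℝ (Fin N)), InG G ∧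
        ∫⁻ x in G, ENNReal.ofReal (V x) < ⊤) :
    (⨅ φ : {φ : EuclideanSpace ℝ (Fin N) → ℝ //
        ContDiff ℝ (⊤ : ℕ∞) φ ∧ HasCompactSupport φ ∧ ∫ x, (φ x) ^ 2 = 1},
      gagliardoSq s φ.1 + ∫⁻ x, ENNReal.ofReal (V x * (φ.1 x) ^ 2)) = 0 := by
  obtain ⟨G, ⟨hGo, hGb⟩, hGV⟩ := hG
  have : Nonempty (Fin N) := ⟨⟨0, hN⟩⟩
  obtain ⟨φ, hφ1, hφ2, hφ3, hφ4⟩ := aux_bump N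
  obtain ⟨L, hL⟩ := hφ1.lipschitzWith_of_hasCompactSupport hφ2 (by simp)
  obtain ⟨M, hM⟩ := hφ2.exists_bound_of_continuous hφ1.continuous
  set D : ℝ := (L : ℝ) ^ 2 + 4 * M ^ 2 with hD
  have hD0 : 0 ≤ D := by positivity
  have hdiff : ∀ x y, |φ x - φ y| ^ 2 ≤ D * min (‖x - y‖ ^ 2) 1 := by
    intro x y
    have h1 : |φ x - φ y| ≤ L * ‖x - y‖ := by
      have := hL.dist_le_mul x y
      rwa [Real.dist_eq, dist_eq_norm] at this
    have h2 : |φ x - φ y| ≤ 2 * M := by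
      have hx := hM x
      have hy := hM y
      have := norm_sub_le (φ x) (φ y)
      simp only [Real.norm_eq_abs] at hx hy this
      linarith
    have h3 : |φ x - φ y| ^ 2 ≤ (L * ‖x - y‖) ^ 2 := by gcongr
    have h4 : |φ x - φ y| ^ 2 ≤ (2 * M) ^ 2 := by gcongr
    rcases le_total (‖x - y‖ ^ 2) 1 with h | h
    · rw [min_eq_left h]
      nlinarith [mul_nonneg (sq_nonneg M) (sq_nonneg ‖x - y‖)]
    · rw [min_eq_right h]
      nlinarith [sq_nonneg (L : ℝ)]
  set A := ∫⁻ x in G, ENNReal.ofReal (V x) with hA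
  set B := volume (ball (0 : EuclideanSpace ℝ (Fin N)) 1) with hB
  have hbound : ∀ n : ℕ, (⨅ φ : {φ : EuclideanSpace ℝ (Fin N) → ℝ //
        ContDiff ℝ (⊤ : ℕ∞) φ ∧ HasCompactSupport φ ∧ ∫ x, (φ x) ^ 2 = 1},
      gagliardoSq s φ.1 + ∫⁻ x, ENNReal.ofReal (V x * (φ.1 x) ^ 2)) ≤
      (ENNReal.ofReal D * (2 * B)) * (∫⁻ z : EuclideanSpace ℝ (Fin N),
      ENNReal.ofReal (min ((‖z‖ / ((n : ℝ) + 1)) ^ 2) 1 / ‖z‖ ^ ((N : ℝ) + 2 * s))) +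
      ENNReal.ofReal (M ^ 2 * (1 / ((n : ℝ) + 1)) ^ N) * A := by
    intro n
    set R : ℝ := (n : ℝ) + 1 with hRdef
    have hR : 0 < R := by positivity
    obtain ⟨x₀, hx₀⟩ := hGb R hR
    set a : ℝ := (Real.sqrt (R ^ N))⁻¹ with ha
    have hRN : 0 < R ^ N := by positivity
    have ha2 : a ^ 2 = (R ^ N)⁻¹ := by rw [ha, inv_pow, Real.sq_sqrt hRN.le]
    let ψ : EuclideanSpace ℝ (Fin N) → ℝ := fun x => a * φ (R⁻¹ • (x - x₀))
    have hψ0 : ∀ x, x ∉ ball x₀ R → ψ x = 0 := by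
      intro x hx
      have : φ (R⁻¹ • (x - x₀)) = 0 := by
        apply hφ4
        rw [mem_ball, dist_eq_norm, not_lt] at hx
        rw [mem_ball_zero_iff, not_lt, norm_smul, norm_inv, Real.norm_of_nonneg hR.le,
          inv_mul_eq_div, le_div_iff₀ hR]
        linarith
      simp [ψ, this]
    have hψ1 : ContDiff ℝ (⊤ : ℕ∞) ψ := by
      apply contDiff_const.mul
      exact hφ1.comp (g := φ) (f := fun x => R⁻¹ • (x - x₀)) (by fun_prop)
    have hψ2 : HasCompactSupport ψ := by
      refine HasCompactSupport.intro (isCompact_closedBall x₀ R) fun x hx => hψ0 x ?_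
      exact fun h => hx (ball_subset_closedBall h)
    have hψ3 : ∫ x, (ψ x) ^ 2 = 1 := by
      simp only [ψ, mul_pow]
      rw [integral_const_mul,
        integral_sub_right_eq_self (fun x => (φ (R⁻¹ • x)) ^ 2) x₀,
        Measure.integral_comp_inv_smul volume (fun x => (φ x) ^ 2) R, hφ3, ha2]
      simp [abs_of_pos hR, hRN.ne']
    refine (iInf_le _ ⟨ψ, hψ1, hψ2, hψ3⟩).trans (add_le_add ?_ ?_)
    · refine (aux_gag s ψ (ball x₀ R) measurableSet_ball (fun z => ENNReal.ofReal
        (min ((‖z‖ / R) ^ 2) 1 / ‖z‖ ^ ((N : ℝ) + 2 * s))) (by fun_prop)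
        (ENNReal.ofReal ((R ^ N)⁻¹ * D)) ?_ hψ0).trans ?_
      · intro x y _
        rw [← ENNReal.ofReal_mul (by positivity)]
        apply ENNReal.ofReal_le_ofReal
        rw [← mul_div_assoc]
        gcongr
        have h1 := hdiff (R⁻¹ • (x - x₀)) (R⁻¹ • (y - x₀))
        rw [← smul_sub, sub_sub_sub_cancel_right, norm_smul, norm_inv,
          Real.norm_of_nonneg hR.le, inv_mul_eq_div] at h1
        simp only [ψ]
        rw [← mul_sub, abs_mul, mul_pow, sq_abs a, ha2, mul_assoc]
        gcongr
      · rw [Measure.addHaar_ball volume x₀ hR.le, finrank_euclideanSpace, Fintype.card_fin,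
          ← hB, ENNReal.ofReal_mul (by positivity)]
        have hc : ENNReal.ofReal (R ^ N)⁻¹ * ENNReal.ofReal (R ^ N) = 1 := by
          rw [← ENNReal.ofReal_mul (by positivity), inv_mul_cancel₀ hRN.ne', ENNReal.ofReal_one]
        apply le_of_eq
        generalize (∫⁻ z : EuclideanSpace ℝ (Fin N), ENNReal.ofReal
          (min ((‖z‖ / R) ^ 2) 1 / ‖z‖ ^ ((N : ℝ) + 2 * s))) = J
        calc _ = (ENNReal.ofReal (R ^ N)⁻¹ * ENNReal.ofReal (R ^ N)) *
              (ENNReal.ofReal D * (2 * B) * J) := by ring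
          _ = _ := by rw [hc, one_mul]
    · rw [hA, ← lintegral_const_mul _ (by fun_prop), ← lintegral_indicator hGo.measurableSet]
      refine lintegral_mono fun x => ?_
      by_cases hx : x ∈ ball x₀ R
      · rw [Set.indicator_of_mem (hx₀ hx), ← ENNReal.ofReal_mul (by positivity)]
        apply ENNReal.ofReal_le_ofReal
        have h1 : (φ (R⁻¹ • (x - x₀))) ^ 2 ≤ M ^ 2 := by
          rw [← sq_abs]
          have := hM (R⁻¹ • (x - x₀))
          rw [Real.norm_eq_abs] at this
          gcongr
        have h2 : (1 / R) ^ N = (R ^ N)⁻¹ := by rw [one_div, inv_pow]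
        simp only [ψ]
        rw [mul_pow, ha2, h2, mul_comm (V x), mul_comm (M ^ 2)]
        gcongr
        exact hV0 x
      · simp [hψ0 x hx]
  have hlim : Tendsto (fun n : ℕ => (ENNReal.ofReal D * (2 * B)) *
      (∫⁻ z : EuclideanSpace ℝ (Fin N),
      ENNReal.ofReal (min ((‖z‖ / ((n : ℝ) + 1)) ^ 2) 1 / ‖z‖ ^ ((N : ℝ) + 2 * s))) +
      ENNReal.ofReal (M ^ 2 * (1 / ((n : ℝ) + 1)) ^ N) * A) atTop (nhds 0) := by
    have hc : ENNReal.ofReal D * (2 * B) ≠ ⊤ :=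
      ENNReal.mul_ne_top ENNReal.ofReal_ne_top
        (ENNReal.mul_ne_top (by simp) measure_ball_lt_top.ne)
    have h1 := ENNReal.Tendsto.const_mul (aux_tendsto hN hs) (Or.inr hc)
    have h2 : Tendsto (fun n : ℕ => M ^ 2 * (1 / ((n : ℝ) + 1)) ^ N) atTop (nhds 0) := by
      have := ((tendsto_one_div_add_atTop_nhds_zero_nat (𝕜 := ℝ)).pow N).const_mul (M ^ 2)
      rwa [zero_pow (by omega), mul_zero] at this
    have h3 := ENNReal.Tendsto.mul_const (b := A) (ENNReal.tendsto_ofReal h2) (Or.inr hGV.ne)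
    have h4 := h1.add h3
    simpa using h4
  exact le_antisymm (ge_of_tendsto' hlim hbound) zero_le
end

section
/- Let N ≥ 1 and let V : ℝ^N → [0,∞) be measurable. Suppose there exists an open set G ∈ 𝒢 with ∫_G V(x) dx < ∞. Then inf { ∫_{ℝ^N} |∇φ(x)|² dx + ∫_{ℝ^N} V(x) |φ(x)|² dx : φ ∈ C_c^∞(ℝ^N), ‖φ‖_{L²(ℝ^N)} = 1 } = 0. -/
open MeasureTheory Metric Filter ENNReal

theorem stmt15_aux {N : ℕ} : ∃ f : EuclideanSpace ℝ (Fin N) → ℝ,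
    ContDiff ℝ (⊤ : ℕ∞) f ∧ HasCompactSupport f ∧ (∫ x, (f x) ^ 2 = 1) ∧
    (∃ B : ℝ, 0 ≤ B ∧ ∀ x, f x ^ 2 ≤ B) ∧ (∀ x, f x ≠ 0 → ‖x‖ < 1) := by
  let b : ContDiffBump (0 : EuclideanSpace ℝ (Fin N)) := ⟨1/2, 1, by norm_num, by norm_num⟩
  have hc : Continuous (fun x => (b x)^2) := b.continuous.pow 2
  have hs : HasCompactSupport (fun x => (b x)^2) := by
    have := b.hasCompactSupport.comp_left (g := fun t : ℝ => t^2) (by norm_num)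
    exact this
  have hpos : 0 < ∫ x, (b x)^2 := by
    refine hc.integral_pos_of_hasCompactSupport_nonneg_nonzero hs (fun x => sq_nonneg _) (x := 0) ?_
    have : b 0 = 1 := b.one_of_mem_closedBall (by simp; exact b.rIn_pos.le)
    simp [this]
  set c := ∫ x, (b x)^2 with hcdef
  refine ⟨fun x => (Real.sqrt c)⁻¹ * b x, contDiff_const.mul b.contDiff,
    b.hasCompactSupport.mul_left, ?_, ⟨c⁻¹, by positivity, fun x => ?_⟩, ?_⟩
  · simp only [mul_pow, integral_const_mul, inv_pow, Real.sq_sqrt hpos.le]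
    rw [← hcdef]; exact inv_mul_cancel₀ hpos.ne'
  · simp only [mul_pow, inv_pow, Real.sq_sqrt hpos.le]
    have h1 : b x ^ 2 ≤ 1 := pow_le_one₀ b.nonneg b.le_one
    have : 0 < c⁻¹ := by positivity
    nlinarith
  · intro x hx
    have h : b x ≠ 0 := right_ne_zero_of_mul hx
    have : x ∈ Function.support b := h
    rw [b.support_eq] at this
    simpa using this

theorem stmt15_scale {N : ℕ} (f : EuclideanSpace ℝ (Fin N) → ℝ) (hf : ContDiff ℝ (⊤ : ℕ∞) f)
    (R : ℝ) (a : ℝ) (x₀ x : EuclideanSpace ℝ (Fin N)) :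
    ‖gradient (fun x => a * f (R⁻¹ • (x - x₀))) x‖ ^ 2
      = (a * R⁻¹) ^ 2 * ‖fderiv ℝ f (R⁻¹ • (x - x₀))‖ ^ 2 := by
  have hd : DifferentiableAt ℝ f (R⁻¹ • (x - x₀)) :=
    (hf.differentiable (by simp)) _
  have h2 : HasFDerivAt (fun x : EuclideanSpace ℝ (Fin N) => R⁻¹ • (x - x₀))
      (R⁻¹ • ContinuousLinearMap.id ℝ (EuclideanSpace ℝ (Fin N))) x :=
    ((hasFDerivAt_id x).sub_const x₀).const_smul R⁻¹
  have h3 := (hd.hasFDerivAt.comp x h2).const_mul a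
  have h4 : fderiv ℝ (fun x => a * f (R⁻¹ • (x - x₀))) x
      = (a * R⁻¹) • fderiv ℝ f (R⁻¹ • (x - x₀)) := by
    refine h3.fderiv.trans ?_
    ext v
    simp [mul_assoc]
  unfold gradient
  rw [LinearIsometryEquiv.norm_map, h4, norm_smul, mul_pow, Real.norm_eq_abs, sq_abs]

theorem stmt15_cov {N : ℕ} (g : EuclideanSpace ℝ (Fin N) → ℝ) (R : ℝ) (hR : 0 < R)
    (x₀ : EuclideanSpace ℝ (Fin N)) :
    ∫ x, g (R⁻¹ • (x - x₀)) = R ^ N * ∫ x, g x := by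
  rw [integral_sub_right_eq_self (fun x => g (R⁻¹ • x)) x₀, Measure.integral_comp_inv_smul]
  simp [abs_of_pos hR]

theorem stmt15 {N : ℕ} (hN : 1 ≤ N)
    (V : EuclideanSpace ℝ (Fin N) → ℝ) (hV : Measurable V) (hV0 : ∀ x, 0 ≤ V x)
    (hG : ∃ G : Set (EuclideanSpace ℝ (Fin N)), InG G ∧
        ∫⁻ x in G, ENNReal.ofReal (V x) < ⊤) :
    (⨅ φ : {φ : EuclideanSpace ℝ (Fin N) → ℝ //
        ContDiff ℝ (⊤ : ℕ∞) φ ∧ HasCompactSupport φ ∧ ∫ x, (φ x) ^ 2 = 1},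
      (∫⁻ x, ENNReal.ofReal (‖gradient φ.1 x‖ ^ 2)) +
        ∫⁻ x, ENNReal.ofReal (V x * (φ.1 x) ^ 2)) = 0 := by
  obtain ⟨G, ⟨hGo, hGb⟩, hfin⟩ := hG
  obtain ⟨f, hf, hfs, hf1, ⟨B, hB0, hB⟩, hsupp⟩ := stmt15_aux (N := N)
  set K : ℝ := ∫ x, ‖fderiv ℝ f x‖ ^ 2 with hK
  set A : ℝ≥0∞ := ∫⁻ x in G, ENNReal.ofReal (V x) with hA
  have key : ∀ n : ℕ, (⨅ φ : {φ : EuclideanSpace ℝ (Fin N) → ℝ //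
        ContDiff ℝ (⊤ : ℕ∞) φ ∧ HasCompactSupport φ ∧ ∫ x, (φ x) ^ 2 = 1},
      (∫⁻ x, ENNReal.ofReal (‖gradient φ.1 x‖ ^ 2)) +
        ∫⁻ x, ENNReal.ofReal (V x * (φ.1 x) ^ 2)) ≤
      ENNReal.ofReal (1 / ((n : ℝ) + 1)) * (ENNReal.ofReal K + ENNReal.ofReal B * A) := by
    intro n
    set R : ℝ := (n : ℝ) + 1 with hRdef
    have hR : 0 < R := by positivity
    have hR1 : 1 ≤ R := by rw [hRdef]; linarith [(Nat.cast_nonneg n : (0:ℝ) ≤ n)]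
    obtain ⟨x₀, hx₀⟩ := hGb R hR
    set a : ℝ := Real.sqrt ((R ^ N)⁻¹) with ha
    have ha2 : a ^ 2 = (R ^ N)⁻¹ := Real.sq_sqrt (by positivity)
    have hRN : R ≤ R ^ N := le_self_pow₀ hR1 (by omega)
    have haR : a ^ 2 ≤ 1 / R := by
      rw [ha2, one_div]; exact inv_anti₀ hR hRN
    have hsq : ∫ x, (a * f (R⁻¹ • (x - x₀))) ^ 2 = 1 := by
      simp only [mul_pow, integral_const_mul]
      rw [stmt15_cov (fun y => f y ^ 2) R hR x₀, hf1, ha2]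
      field_simp
    have hsm : ContDiff ℝ (⊤ : ℕ∞) (fun x => a * f (R⁻¹ • (x - x₀))) :=
      contDiff_const.mul (hf.comp ((contDiff_id.sub contDiff_const).const_smul R⁻¹))
    have hcs : HasCompactSupport (fun x => a * f (R⁻¹ • (x - x₀))) := by
      refine HasCompactSupport.intro (isCompact_closedBall x₀ R) fun x hx => ?_
      by_contra h
      have h1 := hsupp _ (right_ne_zero_of_mul h)
      rw [norm_smul, norm_inv, Real.norm_of_nonneg hR.le, inv_mul_lt_iff₀ hR, mul_one] at h1
      exact hx (by rw [mem_closedBall, dist_eq_norm]; exact h1.le)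
    refine (iInf_le _ ⟨fun x => a * f (R⁻¹ • (x - x₀)), hsm, hcs, hsq⟩).trans ?_
    rw [mul_add]
    refine add_le_add ?_ ?_
    · simp only [stmt15_scale f hf]
      have hcont : Continuous (fun x => ‖fderiv ℝ f x‖ ^ 2) :=
        (hf.continuous_fderiv (by simp)).norm.pow 2
      have hcs2 : HasCompactSupport (fun x => ‖fderiv ℝ f x‖ ^ 2) :=
        (hfs.fderiv (𝕜 := ℝ)).comp_left (g := fun t => ‖t‖ ^ 2) (by simp)
      have hint : Integrable (fun x => ‖fderiv ℝ f x‖ ^ 2) :=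
        hcont.integrable_of_hasCompactSupport hcs2
      have hint2 : Integrable (fun x => (a * R⁻¹) ^ 2 * ‖fderiv ℝ f (R⁻¹ • (x - x₀))‖ ^ 2) := by
        have h1 := (hint.comp_smul (inv_ne_zero hR.ne')).comp_sub_right x₀
        exact h1.const_mul _
      rw [← ofReal_integral_eq_lintegral_ofReal hint2 (ae_of_all _ fun x => by positivity),
        integral_const_mul, stmt15_cov (fun y => ‖fderiv ℝ f y‖ ^ 2) R hR x₀,
        ← ENNReal.ofReal_mul (by positivity)]
      refine ENNReal.ofReal_le_ofReal ?_
      have hK0 : 0 ≤ K := integral_nonneg fun x => by positivity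
      rw [← hK, ← mul_assoc]
      refine mul_le_mul_of_nonneg_right ?_ hK0
      rw [mul_pow, ha2]
      have : (R ^ N)⁻¹ * R⁻¹ ^ 2 * R ^ N = R⁻¹ ^ 2 := by field_simp
      rw [this, one_div]
      exact pow_le_of_le_one (by positivity) (inv_le_one_of_one_le₀ hR1) (by norm_num)
    · rw [hA, ← mul_assoc, ← lintegral_const_mul _ (by fun_prop),
        ← lintegral_indicator hGo.measurableSet]
      refine lintegral_mono fun x => ?_
      by_cases hx : x ∈ G
      · rw [Set.indicator_of_mem hx, ← ENNReal.ofReal_mul (by positivity),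
          ← ENNReal.ofReal_mul (by positivity)]
        refine ENNReal.ofReal_le_ofReal ?_
        show V x * (a * f (R⁻¹ • (x - x₀))) ^ 2 ≤ _
        rw [mul_comm, mul_pow]
        exact mul_le_mul_of_nonneg_right
          (mul_le_mul haR (hB _) (sq_nonneg _) (by positivity)) (hV0 x)
      · have h0 : a * f (R⁻¹ • (x - x₀)) = 0 := by
          by_contra h
          have h1 := hsupp _ (right_ne_zero_of_mul h)
          rw [norm_smul, norm_inv, Real.norm_of_nonneg hR.le, inv_mul_lt_iff₀ hR, mul_one] at h1
          exact hx (hx₀ (by rw [mem_ball, dist_eq_norm]; exact h1))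
        simp [h0]
  have hC : ENNReal.ofReal K + ENNReal.ofReal B * A ≠ ⊤ :=
    ENNReal.add_ne_top.2 ⟨ENNReal.ofReal_ne_top, ENNReal.mul_ne_top ENNReal.ofReal_ne_top hfin.ne⟩
  have hlim : Tendsto (fun n : ℕ => ENNReal.ofReal (1 / ((n : ℝ) + 1)) *
      (ENNReal.ofReal K + ENNReal.ofReal B * A)) atTop (nhds 0) := by
    have h1 := ENNReal.tendsto_ofReal (tendsto_one_div_add_atTop_nhds_zero_nat (𝕜 := ℝ))
    have h2 := ENNReal.Tendsto.mul_const h1 (Or.inr hC)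
    simpa only [ENNReal.ofReal_zero, zero_mul] using h2
  exact le_antisymm (ge_of_tendsto' hlim key) zero_le
end
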